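/- For every odd integer g ≥ 3 and every even integer n with n ≥ 2g, there exists an OF(2n, g). -/

import Mathlib

/-- The weight of a word of length `m` over `ℤ_q` (represented as `Fin q`):
the number of nonzero coordinates. -/
def wordWeight {m q : ℕ} (x : Fin m → Fin q) : ℕ :=
  (Finset.univ.filter (fun i => (x i : ℕ) ≠ 0)).card

/-- The set `H(m)` of all words of length `m` and weight `2` over `ℤ_{g+1}`. -/
def weightTwoWords (m g : ℕ) : Finset (Fin m → Fin (g + 1)) :=
  Finset.univ.filter (fun x => wordWeight x = 2)

/-- A partition of `H(m)` (words of length `m`, weight `2` over `ℤ_{g+1}`) into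
`k` subsets, each of cardinality `s`, with pairwise Hamming distance at least
`3` inside each subset. -/
def HasDist3Partition (m g k s : ℕ) : Prop :=
  ∃ P : Fin k → Finset (Fin m → Fin (g + 1)),
    (∀ i j, i ≠ j → Disjoint (P i) (P j)) ∧
    (Finset.univ.biUnion P = weightTwoWords m g) ∧
    (∀ i, (P i).card = s) ∧
    (∀ i, ∀ x ∈ P i, ∀ y ∈ P i, x ≠ y → 3 ≤ hammingDist x y)

/-- An `ODAR(m,g)`: a partition of `H(m)` into `g²` subsets, each of
cardinality `C(m,2)` and with pairwise Hamming distance at least 3. -/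
def IsODAR (m g : ℕ) : Prop :=
  HasDist3Partition m g (g ^ 2) (m.choose 2)

/-- An `OF(m,g)`: a partition of `H(m)` into `g(m-1)` subsets, each of
cardinality `g·m/2` and with pairwise Hamming distance at least 3. -/
def IsOF (m g : ℕ) : Prop :=
  HasDist3Partition m g (g * (m - 1)) (g * m / 2)

section core
set_option linter.unusedSectionVars false
set_option linter.unusedVariables false
variable {G K N : Type*} [AddCommGroup G] [DecidableEq G] [AddCommGroupWithOne K] [CommRing N]

/-- colour index for arcs with positive level difference -/
def tpos (η : G) (lam : G → K × Bool) (psi : G → N) (e : ℤ) (i j : Bool × G) : (K × Bool) ⊕ N :=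
  if i.1 = j.1 then
    (if j.2 - i.2 = η then Sum.inl (-(e : K), xor (lam i.2).2 i.1)
      else Sum.inl ((lam (j.2 - i.2)).1 - (e : K), (lam (j.2 - i.2)).2))
  else if i.2 = j.2 then Sum.inl (-(e : K), xor (!(lam i.2).2) i.1)
  else if i.1 = false then Sum.inr (psi (j.2 - i.2) - 2 * (e : N))
  else Sum.inr (psi (i.2 - j.2) - 1 - 2 * (e : N))

/-- colour index for horizontal edges -/
def tzero (lam : G → K × Bool) (col : G → G → N) (i j : Bool × G) : (K × Bool) ⊕ N :=
  if i.1 = j.1 then Sum.inr (col i.2 j.2)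
  else Sum.inl (lam (if i.1 = false then j.2 - i.2 else i.2 - j.2))

/-- colour index for all edges -/
def tau (η : G) (lam : G → K × Bool) (psi : G → N) (col : G → G → N) (e : ℤ) (i j : Bool × G) :
    (K × Bool) ⊕ N :=
  if 0 < e then tpos η lam psi e i j else if e = 0 then tzero lam col i j
  else tpos η lam psi (-e) j i

variable {η : G} {lam : G → K × Bool} {psi : G → N} {col : G → G → N}

theorem tau_symm (hcs : ∀ u v, col u v = col v u) (e : ℤ) (i j : Bool × G) :
    tau η lam psi col (-e) j i = tau η lam psi col e i j := by
  rcases lt_trichotomy e 0 with h | h | h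
  · simp [tau, h, not_lt.2 h.le, h.ne]
  · subst h
    obtain ⟨s, u⟩ := i
    obtain ⟨t, v⟩ := j
    cases s <;> cases t <;> simp [tau, tzero, hcs u v]
  · simp [tau, h, not_lt.2 h.le, h.ne']

structure Good (η : G) (lam : G → K × Bool) (psi : G → N) (col : G → G → N) : Prop where
  eta0 : η ≠ 0
  etan : -η = η
  laminj : Function.Injective lam
  lamzero : lam 0 = (0, true)
  lam0 : ∀ d, (lam d).1 = 0 → d = 0 ∨ d = η
  lamneg : ∀ d, (lam (-d)).1 = (lam d).1
  lamflip : ∀ d, d ≠ 0 → d ≠ η → (lam (-d)).2 = !(lam d).2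
  sig : ∀ d, (lam (d + η)).2 = !(lam d).2
  psiinj : ∀ c d, c ≠ 0 → d ≠ 0 → psi c = psi d → c = d
  cols : ∀ u v, col u v = col v u
  colinj : ∀ u v w, v ≠ u → w ≠ u → col u v = col u w → v = w

theorem tpos_inj_right (H : Good η lam psi col) (e : ℤ) (i j j' : Bool × G) (hj : j ≠ i) (hj' : j' ≠ i)
    (h : tpos η lam psi e i j = tpos η lam psi e i j') : j = j' := by
  obtain ⟨s, u⟩ := i
  obtain ⟨t, v⟩ := j
  obtain ⟨t', w⟩ := j'
  have h1 := H.laminj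
  have h2 := H.lam0
  have h4 : ∀ c d, (lam c).1 = (lam d).1 → (lam c).2 = (lam d).2 → c = d :=
    fun c d h h' => h1 (Prod.ext h h')
  have h3 := H.psiinj
  simp only [tpos] at h
  have e1 : u = v ↔ v - u = 0 := by rw [sub_eq_zero]; exact eq_comm
  have e2 : u = w ↔ w - u = 0 := by rw [sub_eq_zero]; exact eq_comm
  have e3 : v - u = w - u ↔ v = w := by simp
  have e5 : u - v = u - w ↔ v = w := by simp
  have e6 : u - v = 0 ↔ u = v := sub_eq_zero
  have e7 : u - w = 0 ↔ u = w := sub_eq_zero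
  have h0 := H.eta0
  have a1 := h2 (v-u)
  have a2 := h2 (w-u)
  have a3 := h4 (v-u) (w-u)
  have a4 := h3 (v-u) (w-u)
  have a5 := h3 (u-v) (u-w)
  clear H h1 h2 h3 h4
  cases s <;> cases t <;> cases t' <;> simp at h hj hj' ⊢ <;> split_ifs at h <;> simp at h <;> grind

theorem tpos_inj_left (H : Good η lam psi col) (e : ℤ) (i j j' : Bool × G) (hj : j ≠ i) (hj' : j' ≠ i)
    (h : tpos η lam psi e j i = tpos η lam psi e j' i) : j = j' := by
  obtain ⟨s, u⟩ := i
  obtain ⟨t, v⟩ := j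
  obtain ⟨t', w⟩ := j'
  have h1 := H.laminj
  have h2 := H.lam0
  have h4 : ∀ c d, (lam c).1 = (lam d).1 → (lam c).2 = (lam d).2 → c = d :=
    fun c d h h' => h1 (Prod.ext h h')
  have h3 := H.psiinj
  simp only [tpos] at h
  have e1 : u = v ↔ u - v = 0 := by rw [sub_eq_zero]
  have e2 : u = w ↔ u - w = 0 := by rw [sub_eq_zero]
  have e3 : v - u = w - u ↔ v = w := by simp
  have e5 : u - v = u - w ↔ v = w := by simp
  have e6 : v - u = 0 ↔ u = v := by rw [sub_eq_zero]; exact eq_comm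
  have e7 : w - u = 0 ↔ u = w := by rw [sub_eq_zero]; exact eq_comm
  have h0 := H.eta0
  have a1 := h2 (u-v)
  have a2 := h2 (u-w)
  have a3 := h4 (u-v) (u-w)
  have a4 := h3 (v-u) (w-u)
  have a5 := h3 (u-v) (u-w)
  have a6 : u - v = η → (lam u).2 = !(lam v).2 := by
    intro h; rw [← H.sig, ← h]; simp
  have a7 : u - w = η → (lam u).2 = !(lam w).2 := by
    intro h; rw [← H.sig, ← h]; simp
  clear H h1 h2 h3 h4
  cases s <;> cases t <;> cases t' <;> simp at h hj hj' ⊢ <;> split_ifs at h <;> simp at h <;> grind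

theorem tzero_inj (H : Good η lam psi col) (i j j' : Bool × G) (hj : j ≠ i) (hj' : j' ≠ i)
    (h : tzero lam col i j = tzero lam col i j') : j = j' := by
  obtain ⟨s, u⟩ := i
  obtain ⟨t, v⟩ := j
  obtain ⟨t', w⟩ := j'
  have h1 := H.colinj u v w
  simp only [tzero] at h
  cases s <;> cases t <;> cases t' <;> simp [H.laminj.eq_iff] at h hj hj' ⊢ <;> grind

theorem tau_inj (H : Good η lam psi col) (e : ℤ) (i j j' : Bool × G) (hj : j ≠ i) (hj' : j' ≠ i)
    (h : tau η lam psi col e i j = tau η lam psi col e i j') : j = j' := by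
  simp only [tau] at h
  split_ifs at h
  · exact tpos_inj_right H _ _ _ _ hj hj' h
  · exact tzero_inj H _ _ _ hj hj' h
  · exact tpos_inj_left H _ _ _ _ hj hj' h

theorem tpos_ne_zero (H : Good η lam psi col) (m : ℤ)
    (hK : ∀ a b : ℤ, 0 ≤ a → a ≤ m → 0 ≤ b → b ≤ m → (a : K) = b → a = b)
    (e : ℤ) (he : 0 < e) (hem : e ≤ m) (i j : Bool × G) (hij : i ≠ j) :
    tpos η lam psi e i j ≠ tzero lam col i j := by
  have h0 := hK e 0 he.le hem le_rfl (he.le.trans hem)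
  rw [Int.cast_zero] at h0
  obtain ⟨s, u⟩ := i
  obtain ⟨t, v⟩ := j
  have := H.lamzero
  intro h
  simp only [tpos, tzero] at h
  by_cases huv : u = v
  · subst huv
    cases s <;> cases t <;> simp [H.lamzero] at h hij <;> grind
  · cases s <;> cases t <;> simp [huv] at h hij <;> split_ifs at h

theorem tpos_inj_e (H : Good η lam psi col) (m : ℤ)
    (hK : ∀ a b : ℤ, 0 ≤ a → a ≤ m → 0 ≤ b → b ≤ m → (a : K) = b → a = b)
    (hN : ∀ a b : ℤ, 0 ≤ a → a ≤ 2 * m → 0 ≤ b → b ≤ 2 * m → (a : N) = b → a = b)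
    (e f : ℤ) (he : 0 < e) (hem : e ≤ m) (hf : 0 < f) (hfm : f ≤ m) (i j : Bool × G)
    (h : tpos η lam psi e i j = tpos η lam psi f i j) : e = f := by
  have h0 := hK e f he.le hem hf.le hfm
  have h1 := hN (2 * e) (2 * f) (by omega) (by omega) (by omega) (by omega)
  push_cast at h1
  simp only [tpos] at h
  split_ifs at h <;> simp at h <;> grind

theorem tpos_ne_swap (H : Good η lam psi col) (m : ℤ)
    (hK : ∀ a b : ℤ, 0 ≤ a → a ≤ m → 0 ≤ b → b ≤ m → (a : K) = b → a = b)
    (hN : ∀ a b : ℤ, 0 ≤ a → a ≤ 2 * m → 0 ≤ b → b ≤ 2 * m → (a : N) = b → a = b)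
    (e f : ℤ) (he : 0 < e) (hem : e ≤ m) (hf : 0 < f) (hfm : f ≤ m) (i j : Bool × G) (hij : i ≠ j) :
    tpos η lam psi e i j ≠ tpos η lam psi f j i := by
  intro h
  have h1 := hN (2 * e - 1) (2 * f) (by omega) (by omega) (by omega) (by omega)
  have h2 := hN (2 * e) (2 * f - 1) (by omega) (by omega) (by omega) (by omega)
  push_cast at h1 h2
  obtain ⟨s, u⟩ := i
  obtain ⟨t, v⟩ := j
  simp only [tpos] at h
  have hneg : u - v = -(v - u) := by simp
  have e1 : u = v ↔ v - u = 0 := by rw [sub_eq_zero]; exact eq_comm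
  have e2 : v = u ↔ v - u = 0 := by rw [sub_eq_zero]
  have e3 : u - v = η ↔ v - u = η := by rw [hneg, neg_eq_iff_eq_neg, H.etan]
  have a6 : v - u = η → (lam v).2 = !(lam u).2 := by
    intro h; rw [← H.sig, ← h]; simp
  have a7 := H.lamneg (v - u)
  have a8 := H.lamflip (v - u)
  rw [← hneg] at a7 a8
  clear hneg
  have h3 : 2 * (e : N) - 1 ≠ 2 * f := fun h => by have := h1 h; omega
  have h4 : 2 * (e : N) ≠ 2 * f - 1 := fun h => by have := h2 h; omega
  clear H hK hN h1 h2
  cases s <;> cases t <;> simp at h hij <;> split_ifs at h <;> simp at h <;> grind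

theorem tau_inj_e (H : Good η lam psi col) (m : ℤ)
    (hK : ∀ a b : ℤ, 0 ≤ a → a ≤ m → 0 ≤ b → b ≤ m → (a : K) = b → a = b)
    (hN : ∀ a b : ℤ, 0 ≤ a → a ≤ 2 * m → 0 ≤ b → b ≤ 2 * m → (a : N) = b → a = b)
    (e f : ℤ) (he : |e| ≤ m) (hf : |f| ≤ m) (i j : Bool × G) (hij : i ≠ j)
    (h : tau η lam psi col e i j = tau η lam psi col f i j) : e = f := by
  rw [abs_le] at he hf
  have hs : tzero lam col j i = tzero lam col i j := by
    have := tau_symm (η := η) (lam := lam) (psi := psi) H.cols 0 i j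
    simpa [tau] using this
  simp only [tau] at h
  split_ifs at h
  · exact tpos_inj_e H m hK hN _ _ (by omega) (by omega) (by omega) (by omega) _ _ h
  · exact absurd h (tpos_ne_zero H m hK _ (by omega) (by omega) _ _ hij)
  · exact absurd h (tpos_ne_swap H m hK hN _ _ (by omega) (by omega) (by omega) (by omega) _ _ hij)
  · exact absurd h.symm (tpos_ne_zero H m hK _ (by omega) (by omega) _ _ hij)
  · omega
  · rw [← hs] at h
    exact absurd h.symm (tpos_ne_zero H m hK _ (by omega) (by omega) _ _ hij.symm)
  · exact absurd h.symm (tpos_ne_swap H m hK hN _ _ (by omega) (by omega) (by omega) (by omega) _ _ hij)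
  · rw [← hs] at h
    exact absurd h (tpos_ne_zero H m hK _ (by omega) (by omega) _ _ hij.symm)
  · have := tpos_inj_e H m hK hN _ _ (by omega) (by omega) (by omega) (by omega) _ _ h
    omega
end core

theorem zmod_cast_inj (c : ℕ) (a b : ℤ) (h : (a : ZMod c) = b) (hab : |b - a| < c) : a = b := by
  rw [ZMod.intCast_eq_intCast_iff_dvd_sub] at h
  have := Int.eq_zero_of_abs_lt_dvd h hab
  omega

theorem zmod_natCast_inj (c : ℕ) (a b : ℕ) (h : (a : ZMod c) = b) (h1 : a < b + c) (h2 : b < a + c) :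
    a = b := by
  have := zmod_cast_inj c a b (by exact_mod_cast h) (by rw [abs_lt]; omega)
  exact_mod_cast this

/-- class of a difference -/
def lamZ (k : ℕ) (d : ZMod (2 * k)) : ZMod k × Bool :=
  (if d.val < k then (d.val : ZMod k) else -(d.val : ZMod k), decide (d.val < k))

/-- one-factorization of the complete graph on `n` vertices -/
def colZ (n : ℕ) (u v : ZMod n) : ZMod (n - 1) :=
  if u.val = n - 1 then 2 * (v.val : ZMod (n - 1)) else
  if v.val = n - 1 then 2 * (u.val : ZMod (n - 1)) else (u.val : ZMod (n - 1)) + v.val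

theorem good_zmod (k : ℕ) (hk : 2 ≤ k) :
    Good (k : ZMod (2 * k)) (lamZ k) (fun d => (d.val : ZMod (2 * k - 1))) (colZ (2 * k)) := by
  have : NeZero (2 * k) := ⟨by omega⟩
  have hlt : ∀ d : ZMod (2 * k), d.val < 2 * k := fun d => ZMod.val_lt d
  have hv : ∀ c d : ZMod (2 * k), c.val = d.val → c = d := fun c d h => ZMod.val_injective _ h
  have hkv : (k : ZMod (2 * k)).val = k := ZMod.val_natCast_of_lt (by omega)
  have h0v : (0 : ZMod (2 * k)).val = 0 := ZMod.val_zero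
  have hv0 : ∀ d : ZMod (2 * k), d.val = 0 → d = 0 := fun d h => hv _ _ (by omega)
  have hnv : ∀ d : ZMod (2 * k), d ≠ 0 → (-d).val = 2 * k - d.val := fun d h => by
    rw [ZMod.neg_val, if_neg h]
  have hk0 : (k : ZMod (2 * k)) ≠ 0 := fun h => by rw [h] at hkv; omega
  have hflip : ∀ d : ZMod (2 * k), (-(d.val : ZMod k)) = ((2 * k - d.val : ℕ) : ZMod k) := fun d => by
    rw [Nat.cast_sub (hlt d).le]; simp
  have h2 : ∀ a b : ℕ, a < 2 * k - 1 → b < 2 * k - 1 → 2 * (a : ZMod (2 * k - 1)) = 2 * b → a = b := by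
    intro a b ha hb h
    have hu : IsUnit ((2 : ℕ) : ZMod (2 * k - 1)) := by
      rw [ZMod.isUnit_iff_coprime]
      rw [Nat.coprime_two_left]
      exact ⟨k - 1, by omega⟩
    push_cast at hu
    exact zmod_natCast_inj _ _ _ (hu.mul_left_cancel h) (by omega) (by omega)
  refine ⟨hk0, ?_, ?_, ?_, ?_, ?_, ?_, ?_, ?_, ?_, ?_⟩
  · apply hv; rw [hnv _ hk0]; omega
  · intro c d h
    have hc := hlt c
    have hd := hlt d
    simp only [lamZ, Prod.mk.injEq, decide_eq_decide] at h
    obtain ⟨h, h'⟩ := h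
    apply hv
    split_ifs at h
    · exact zmod_natCast_inj _ _ _ h (by omega) (by omega)
    · omega
    · omega
    · exact zmod_natCast_inj _ _ _ (neg_injective h) (by omega) (by omega)
  · simp [lamZ]; omega
  · intro d h
    have hd := hlt d
    simp only [lamZ] at h
    split_ifs at h
    · left; apply hv0
      exact zmod_natCast_inj k _ _ (by simpa using h) (by omega) (by omega)
    · right; apply hv; rw [hkv]
      exact zmod_natCast_inj k _ _ (by simpa using h) (by omega) (by omega)
  · intro d
    by_cases hd : d = 0
    · simp [hd]
    have hd' : d.val ≠ 0 := fun h => hd (hv0 d h)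
    have := hlt d
    simp only [lamZ]
    rw [hnv d hd]
    rcases lt_trichotomy d.val k with h | h | h
    · rw [if_neg (by omega), if_pos h, ← hflip, neg_neg]
    · rw [if_neg (by omega), if_neg (by omega), ← hflip, h]; simp
    · rw [if_pos (by omega), if_neg (by omega), ← hflip]
  · intro d hd hdk
    have hd' : d.val ≠ 0 := fun h => hd (hv0 d h)
    have hd'' : d.val ≠ k := fun h => hdk (hv _ _ (by omega))
    have := hlt d
    simp only [lamZ]
    rw [hnv d hd]
    by_cases h : d.val < k
    · simp [h]; omega
    · simp [h]; omega
  · intro d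
    have := hlt d
    simp only [lamZ]
    rw [ZMod.val_add, hkv]
    by_cases h : d.val < k
    · rw [Nat.mod_eq_of_lt (by omega)]; simp [h]
    · rw [Nat.mod_eq_sub_mod (by omega), Nat.mod_eq_of_lt (by omega)]; simp [h]; omega
  · intro c d hc hd h
    have hc' : c.val ≠ 0 := fun h => hc (hv0 c h)
    have hd' : d.val ≠ 0 := fun h => hd (hv0 d h)
    have := hlt c
    have := hlt d
    exact hv _ _ (zmod_natCast_inj _ _ _ h (by omega) (by omega))
  · intro u v
    simp only [colZ]
    split_ifs with h h'
    · rw [h, h']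
    · rfl
    · rfl
    · rw [add_comm]
  · intro u v w hvu hwu h
    have a1 := hlt u
    have a2 := hlt v
    have a3 := hlt w
    have b1 : v.val ≠ u.val := fun h => hvu (hv _ _ h)
    have b2 : w.val ≠ u.val := fun h => hwu (hv _ _ h)
    apply hv
    simp only [colZ] at h
    split_ifs at h
    · exact h2 _ _ (by omega) (by omega) h
    · omega
    · rw [two_mul (u.val : ZMod (2 * k - 1))] at h
      exact absurd (zmod_natCast_inj _ _ _ (add_left_cancel h) (by omega) (by omega)) b2.symm
    · rw [two_mul (u.val : ZMod (2 * k - 1))] at h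
      exact absurd (zmod_natCast_inj _ _ _ (add_left_cancel h) (by omega) (by omega)) b1
    · exact zmod_natCast_inj _ _ _ (add_left_cancel h) (by omega) (by omega)

section words
variable {m g : ℕ}

theorem word_other {x : Fin m → Fin (g + 1)} (hx : x ∈ weightTwoWords m g) {p q : Fin m} (hpq : p ≠ q)
    (hp : x p ≠ 0) (hq : x q ≠ 0) (l : Fin m) (h1 : l ≠ p) (h2 : l ≠ q) : x l = 0 := by
  by_contra hl
  simp only [weightTwoWords, Finset.mem_filter, Finset.mem_univ, true_and] at hx
  unfold wordWeight at hx
  have hsub : ({p, q, l} : Finset (Fin m)) ⊆ Finset.univ.filter (fun i => (x i : ℕ) ≠ 0) := by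
    intro i hi
    have h0 : ∀ a : Fin (g + 1), (a : ℕ) = 0 → a = 0 := fun a h => Fin.ext h
    simp only [Finset.mem_insert, Finset.mem_singleton] at hi
    simp only [Finset.mem_filter, Finset.mem_univ, true_and]
    rcases hi with rfl | rfl | rfl
    · exact fun h => hp (h0 _ h)
    · exact fun h => hq (h0 _ h)
    · exact fun h => hl (h0 _ h)
  have := Finset.card_le_card hsub
  rw [Finset.card_eq_three.2 ⟨p, q, l, hpq, h1.symm, h2.symm, rfl⟩] at this
  omega

theorem word_exists {x : Fin m → Fin (g + 1)} (hx : x ∈ weightTwoWords m g) :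
    ∃ p q, p ≠ q ∧ x p ≠ 0 ∧ x q ≠ 0 := by
  simp only [weightTwoWords, Finset.mem_filter, Finset.mem_univ, true_and] at hx
  unfold wordWeight at hx
  obtain ⟨p, q, hpq, h⟩ := Finset.card_eq_two.1 hx
  refine ⟨p, q, hpq, ?_, ?_⟩
  · have : p ∈ Finset.univ.filter (fun i => (x i : ℕ) ≠ 0) := by rw [h]; simp
    simp only [Finset.mem_filter] at this
    intro h; rw [h] at this; simp at this
  · have : q ∈ Finset.univ.filter (fun i => (x i : ℕ) ≠ 0) := by rw [h]; simp
    simp only [Finset.mem_filter] at this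
    intro h; rw [h] at this; simp at this

theorem word_make (i j : Fin m) (hij : i ≠ j) (a b : Fin (g + 1)) (ha : a ≠ 0) (hb : b ≠ 0) :
    ∃ x ∈ weightTwoWords m g, x i = a ∧ x j = b := by
  refine ⟨fun l => if l = i then a else if l = j then b else 0, ?_, by simp, by simp [hij.symm]⟩
  simp only [weightTwoWords, Finset.mem_filter, Finset.mem_univ, true_and]
  unfold wordWeight
  rw [Finset.card_eq_two]
  refine ⟨i, j, hij, ?_⟩
  ext l
  simp only [Finset.mem_filter, Finset.mem_univ, true_and, Finset.mem_insert, Finset.mem_singleton]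
  have ha' : (a : ℕ) ≠ 0 := fun h => ha (Fin.ext h)
  have hb' : (b : ℕ) ≠ 0 := fun h => hb (Fin.ext h)
  split_ifs with h h' <;> simp_all

theorem dist3 {x y : Fin m → Fin (g + 1)} (p q r : Fin m) (h1 : p ≠ q) (h2 : p ≠ r) (h3 : q ≠ r)
    (hp : x p ≠ y p) (hq : x q ≠ y q) (hr : x r ≠ y r) : 3 ≤ hammingDist x y := by
  rw [← Finset.card_eq_three.2 ⟨p, q, r, h1, h2, h3, rfl⟩]
  apply Finset.card_le_card
  intro i hi
  simp only [Finset.mem_insert, Finset.mem_singleton] at hi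
  simp only [Finset.mem_filter, Finset.mem_univ, true_and]
  rcases hi with rfl | rfl | rfl <;> assumption

theorem OF_of_coloring {K : Type*} [Fintype K] (hK : Fintype.card K = g * (m - 1))
    (C : Fin m → Fin (g + 1) → Fin m → Fin (g + 1) → K)
    (hs : ∀ i a j b, C i a j b = C j b i a)
    (h1 : ∀ i a j b j' b', j ≠ i → j' ≠ i → b ≠ 0 → b' ≠ 0 → C i a j b = C i a j' b' → j = j' ∧ b = b')
    (h2 : ∀ i a j b a' b', i ≠ j → a ≠ 0 → a' ≠ 0 → b ≠ 0 → b' ≠ 0 →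
      C i a j b = C i a' j b' → a = a' ∧ b = b') : IsOF m g := by
  classical
  let κ : Fin (g * (m - 1)) ≃ K := (Fintype.equivFinOfCardEq hK).symm
  let P : Fin (g * (m - 1)) → Finset (Fin m → Fin (g + 1)) := fun c =>
    (weightTwoWords m g).filter (fun x => ∃ i j, i ≠ j ∧ x i ≠ 0 ∧ x j ≠ 0 ∧ C i (x i) j (x j) = κ c)
  have hP : ∀ c x, x ∈ P c ↔ x ∈ weightTwoWords m g ∧
      ∃ i j, i ≠ j ∧ x i ≠ 0 ∧ x j ≠ 0 ∧ C i (x i) j (x j) = κ c := fun c x => Finset.mem_filter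
  have key : ∀ c x, x ∈ P c → ∀ p, x p ≠ 0 → ∃ q, q ≠ p ∧ x q ≠ 0 ∧ (∀ l, l ≠ p → l ≠ q → x l = 0) ∧
      C p (x p) q (x q) = κ c := by
    intro c x hx p hp
    obtain ⟨hw, i, j, hij, hi, hj, hc⟩ := (hP c x).1 hx
    have ho := word_other hw hij hi hj
    by_cases hpi : p = i
    · subst hpi
      exact ⟨j, hij.symm, hj, ho, hc⟩
    · by_cases hpj : p = j
      · subst hpj
        exact ⟨i, hij, hi, fun l a b => ho l b a, by rw [hs]; exact hc⟩
      · exact absurd (ho p hpi hpj) hp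
  have uniq : ∀ c x y, x ∈ P c → y ∈ P c → ∀ p, x p ≠ 0 → x p = y p → x = y := by
    intro c x y hx hy p hp hxy
    obtain ⟨q, hq, hq0, hqo, hqc⟩ := key c x hx p hp
    obtain ⟨r, hr, hr0, hro, hrc⟩ := key c y hy p (hxy ▸ hp)
    rw [← hrc, hxy] at hqc
    obtain ⟨rfl, hb⟩ := h1 _ _ _ _ _ _ hq hr hq0 hr0 hqc
    funext l
    by_cases hl : l = p
    · rw [hl, hxy]
    by_cases hl' : l = q
    · rw [hl', hb]
    rw [hqo l hl hl', hro l hl hl']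
  refine ⟨P, ?_, ?_, ?_, ?_⟩
  · intro c c' hcc
    rw [Finset.disjoint_left]
    intro x hx hx'
    obtain ⟨hw, i, j, hij, hi, hj, hc⟩ := (hP c x).1 hx
    obtain ⟨q, hq, hq0, hqo, hqc⟩ := key c' x hx' i hi
    have : q = j := by
      by_contra hne
      exact hj (hqo j hij.symm (Ne.symm hne))
    subst this
    rw [hc] at hqc
    exact hcc (κ.injective hqc)
  · ext x
    simp only [Finset.mem_biUnion, Finset.mem_univ, true_and]
    constructor
    · rintro ⟨c, hc⟩
      exact ((hP c x).1 hc).1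
    · intro hx
      obtain ⟨p, q, hpq, hp, hq⟩ := word_exists hx
      exact ⟨κ.symm (C p (x p) q (x q)), (hP _ _).2 ⟨hx, p, q, hpq, hp, hq, by simp⟩⟩
  · intro c
    have hdc := Finset.sum_card_bipartiteAbove_eq_sum_card_bipartiteBelow
      (fun (x : Fin m → Fin (g + 1)) (v : Fin m × Fin (g + 1)) => x v.1 = v.2) (s := P c)
      (t := Finset.univ ×ˢ Finset.univ.erase 0)
    have hA : ∀ x ∈ P c, (Finset.bipartiteAbove
        (fun (x : Fin m → Fin (g + 1)) (v : Fin m × Fin (g + 1)) => x v.1 = v.2)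
        (Finset.univ ×ˢ Finset.univ.erase 0) x).card = 2 := by
      intro x hx
      obtain ⟨hw, i, j, hij, hi, hj, hc⟩ := (hP c x).1 hx
      have ho := word_other hw hij hi hj
      rw [Finset.card_eq_two]
      refine ⟨(i, x i), (j, x j), by simp [hij], ?_⟩
      ext ⟨l, a⟩
      simp only [Finset.mem_bipartiteAbove, Finset.mem_product, Finset.mem_univ, true_and,
        Finset.mem_erase, and_true, Finset.mem_insert, Finset.mem_singleton, Prod.mk.injEq]
      constructor
      · rintro ⟨ha, rfl⟩
        by_contra hcon
        push Not at hcon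
        exact ha (ho l (fun h => hcon.1 h (by rw [h])) (fun h => hcon.2 h (by rw [h])))
      · rintro (⟨rfl, rfl⟩ | ⟨rfl, rfl⟩)
        · exact ⟨hi, rfl⟩
        · exact ⟨hj, rfl⟩
    have hB : ∀ v ∈ (Finset.univ : Finset (Fin m)) ×ˢ (Finset.univ : Finset (Fin (g + 1))).erase 0,
        (Finset.bipartiteBelow
        (fun (x : Fin m → Fin (g + 1)) (v : Fin m × Fin (g + 1)) => x v.1 = v.2)
        (P c) v).card = 1 := by
      rintro ⟨i, a⟩ hv
      have ha : a ≠ 0 := by simpa using hv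
      rw [Finset.card_eq_one]
      have hsurj : Function.Bijective (fun w : {j : Fin m // j ≠ i} × {b : Fin (g + 1) // b ≠ 0} =>
          C i a w.1 w.2) := by
        rw [Fintype.bijective_iff_injective_and_card]
        constructor
        · rintro ⟨⟨j, hj⟩, ⟨b, hb⟩⟩ ⟨⟨j', hj'⟩, ⟨b', hb'⟩⟩ h
          obtain ⟨rfl, rfl⟩ := h1 _ _ _ _ _ _ hj hj' hb hb' h
          rfl
        · rw [Fintype.card_prod, hK]
          simp [Fintype.card_subtype_compl, mul_comm]
      obtain ⟨⟨⟨j, hj⟩, ⟨b, hb⟩⟩, hjb⟩ := hsurj.2 (κ c)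
      obtain ⟨x, hx, hxi, hxj⟩ := word_make i j hj.symm a b ha hb
      have hxP : x ∈ P c := (hP c x).2 ⟨hx, i, j, hj.symm, by rwa [hxi], by rwa [hxj], by
        rw [hxi, hxj]; exact hjb⟩
      refine ⟨x, ?_⟩
      ext y
      simp only [Finset.mem_bipartiteBelow, Finset.mem_singleton]
      constructor
      · rintro ⟨hy, hyi⟩
        exact (uniq c x y hxP hy i (by rwa [hxi]) (by rw [hxi, hyi])).symm
      · rintro rfl
        exact ⟨hxP, hxi⟩
    rw [Finset.sum_congr rfl hA, Finset.sum_congr rfl hB] at hdc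
    simp at hdc
    rw [mul_comm m g] at hdc
    omega
  · intro c x hx y hy hxy
    have aux : ∀ i j, i ≠ j → x i ≠ 0 → x j ≠ 0 → C i (x i) j (x j) = κ c →
        (∀ l, l ≠ i → l ≠ j → x l = 0) → y i ≠ 0 → 3 ≤ hammingDist x y := by
      intro i j hij hi hj hc ho hyi
      have hd : x i ≠ y i := fun h => hxy (uniq c x y hx hy i hi h)
      obtain ⟨q, hq, hq0, hqo, hqc⟩ := key c y hy i hyi
      by_cases hqj : q = j
      · subst hqj
        rw [← hc] at hqc
        exact absurd (h2 _ _ _ _ _ _ hij hyi hi hq0 hj hqc).1.symm hd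
      · exact dist3 i j q hij hq.symm (Ne.symm hqj) hd (by rw [hqo j hij.symm (Ne.symm hqj)]; exact hj)
          (by rw [ho q hq hqj]; exact hq0.symm)
    obtain ⟨hw, i, j, hij, hi, hj, hc⟩ := (hP c x).1 hx
    have ho := word_other hw hij hi hj
    by_cases hyi : y i = 0
    · by_cases hyj : y j = 0
      · obtain ⟨_, p, q, hpq, hp, hq, _⟩ := (hP c y).1 hy
        have hpi : p ≠ i := fun h => hp (h ▸ hyi)
        have hpj : p ≠ j := fun h => hp (h ▸ hyj)
        exact dist3 i j p hij hpi.symm hpj.symm (by rwa [hyi]) (by rwa [hyj])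
          (by rw [ho p hpi hpj]; exact hp.symm)
      · exact aux j i hij.symm hj hi (by rw [hs]; exact hc) (fun l a b => ho l b a) hyj
    · exact aux i j hij hi hj hc ho hyi
end words

/-- For every odd `g ≥ 3` and every even `n ≥ 2g`, an `OF(2n,g)` exists. -/
theorem exists_OF_two_n_odd_even (n g : ℕ) (hg3 : 3 ≤ g) (hgo : Odd g)
    (hne : Even n) (hn : 2 * g ≤ n) : IsOF (2 * n) g := by
  obtain ⟨k, rfl⟩ := hne
  rw [← two_mul] at hn ⊢
  obtain ⟨h, rfl⟩ := hgo
  have : NeZero (2 * k) := ⟨by omega⟩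
  have : NeZero (2 * k - 1) := ⟨by omega⟩
  have : NeZero k := ⟨by omega⟩
  have H := good_zmod k (by omega)
  have hKc : ∀ a b : ℤ, 0 ≤ a → a ≤ h → 0 ≤ b → b ≤ h → (a : ZMod k) = b → a = b :=
    fun a b _ _ _ _ e => zmod_cast_inj k a b e (by rw [abs_lt]; omega)
  have hNc : ∀ a b : ℤ, 0 ≤ a → a ≤ 2 * h → 0 ≤ b → b ≤ 2 * h → (a : ZMod (2 * k - 1)) = b → a = b :=
    fun a b _ _ _ _ e => zmod_cast_inj (2 * k - 1) a b e (by rw [abs_lt]; omega)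
  have hcard : Fintype.card (Bool × ZMod (2 * k)) = 2 * (2 * k) := by simp [ZMod.card]
  let E : Fin (2 * (2 * k)) ≃ Bool × ZMod (2 * k) := (Fintype.equivFinOfCardEq hcard).symm
  let t := tau (k : ZMod (2 * k)) (lamZ k) (fun d => (d.val : ZMod (2 * k - 1))) (colZ (2 * k))
  have hneg : ∀ a : ZMod (2 * h + 1), (-a).valMinAbs = -a.valMinAbs := fun a =>
    ZMod.valMinAbs_neg_of_ne_half (by omega)
  have hbd : ∀ a : ZMod (2 * h + 1), |a.valMinAbs| ≤ (h : ℤ) := fun a => by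
    have := ZMod.natAbs_valMinAbs_le a
    rw [Int.abs_eq_natAbs]
    omega
  have hlev : ∀ a b : Fin (2 * h + 1 + 1), a ≠ 0 → b ≠ 0 →
      ((a : ℕ) : ZMod (2 * h + 1)) = ((b : ℕ) : ZMod (2 * h + 1)) → a = b := by
    intro a b ha hb hab
    have ha' : (a : ℕ) ≠ 0 := fun h => ha (Fin.ext h)
    have hb' : (b : ℕ) ≠ 0 := fun h => hb (Fin.ext h)
    exact Fin.ext (zmod_natCast_inj _ _ _ hab (by omega) (by omega))
  have htwo : ∀ a b : ZMod (2 * h + 1), 2 * a = 2 * b → a = b := by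
    intro a b hab
    have hu : IsUnit ((2 : ℕ) : ZMod (2 * h + 1)) := by
      rw [ZMod.isUnit_iff_coprime, Nat.coprime_two_left]
      exact ⟨h, rfl⟩
    push_cast at hu
    exact hu.mul_left_cancel hab
  refine OF_of_coloring (K := ZMod (2 * h + 1) × ((ZMod k × Bool) ⊕ ZMod (2 * k - 1))) ?_
    (fun i a j b => (((a : ℕ) : ZMod (2 * h + 1)) + ((b : ℕ) : ZMod (2 * h + 1)),
      t (((a : ℕ) : ZMod (2 * h + 1)) - ((b : ℕ) : ZMod (2 * h + 1))).valMinAbs (E i) (E j))) ?_ ?_ ?_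
  · simp only [Fintype.card_prod, Fintype.card_sum, ZMod.card, Fintype.card_bool]
    congr 1
    omega
  · intro i a j b
    simp only [Prod.mk.injEq]
    refine ⟨add_comm _ _, ?_⟩
    rw [← neg_sub ((b : ℕ) : ZMod (2 * h + 1)), hneg]
    exact tau_symm H.cols _ _ _
  · intro i a j b j' b' hj hj' hb hb' e
    simp only [Prod.mk.injEq] at e
    obtain ⟨e1, e2⟩ := e
    have e3 := add_left_cancel e1
    obtain rfl := hlev _ _ hb hb' e3
    exact ⟨E.injective (tau_inj H _ _ _ _ (E.injective.ne hj) (E.injective.ne hj') e2), rfl⟩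
  · intro i a j b a' b' hij ha ha' hb hb' e
    simp only [Prod.mk.injEq] at e
    obtain ⟨e1, e2⟩ := e
    have e3 := ZMod.injective_valMinAbs
      (tau_inj_e H h hKc hNc _ _ (hbd _) (hbd _) _ _ (E.injective.ne hij) e2)
    have e4 : a = a' := hlev _ _ ha ha' (htwo _ _ (by linear_combination e1 + e3))
    subst e4
    exact ⟨rfl, hlev _ _ hb hb' (add_left_cancel e1)⟩
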